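/- Let (R,m,k) be a one-dimensional Cohen-Macaulay standard graded ring over an uncountable field that is of graded countable Cohen-Macaulay type. Then e(R) ≤ 3; more precisely, the h-vector of R is one of (1), (1,1), (1,2), (1,1,1). -/

import Mathlib

/-- A (ℤ-)graded module over a graded `k`-algebra `R` with grading `𝒜`. -/
structure GrMod (k R : Type) [Field k] [CommRing R] [Algebra k R]
    (𝒜 : ℕ → Submodule k R) where
  M : Type
  [acg : AddCommGroup M]
  [mod : Module R M]
  gr : ℤ → AddSubgroup M
  internal : DirectSum.IsInternal gr
  smul_mem : ∀ (i : ℕ) (j : ℤ) (r : R) (y : M), r ∈ 𝒜 i → y ∈ gr j → r • y ∈ gr (i + j)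

attribute [instance] GrMod.acg GrMod.mod

variable (k R : Type) [Field k] [CommRing R] [Algebra k R] (𝒜 : ℕ → Submodule k R)

/-- Two graded modules are isomorphic up to a shift in degree. -/
def GrIsoUpToShift (N N' : GrMod k R 𝒜) : Prop :=
  ∃ (e : N.M ≃ₗ[R] N'.M) (s : ℤ), ∀ (j : ℤ) (y : N.M), y ∈ N.gr j → e y ∈ N'.gr (j + s)

/-- The irrelevant maximal ideal of a (standard) graded ring. -/
def gradedIrrelevant : Ideal R :=
  Ideal.span {r : R | ∃ i : ℕ, 0 < i ∧ r ∈ 𝒜 i}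

/-- A maximal Cohen-Macaulay module over a one-dimensional Cohen-Macaulay graded ring. -/
def GrMod.IsMCM (m : Ideal R) (N : GrMod k R 𝒜) : Prop :=
  Module.Finite R N.M ∧ Nontrivial N.M ∧ ∃ r ∈ m, ∀ y : N.M, r • y = 0 → y = 0

/-- A graded module is indecomposable. -/
def GrMod.Indec (N : GrMod k R 𝒜) : Prop :=
  Nontrivial N.M ∧ ∀ p q : Submodule R N.M, IsCompl p q → p = ⊥ ∨ q = ⊥

/-- `R` has graded countable Cohen-Macaulay type. -/
def HasGradedCountableCMType (m : Ideal R) : Prop :=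
  ∃ F : ℕ → GrMod k R 𝒜, ∀ N : GrMod k R 𝒜,
    GrMod.IsMCM k R 𝒜 m N → GrMod.Indec k R 𝒜 N → ∃ i : ℕ, GrIsoUpToShift k R 𝒜 N (F i)

/-- The h-vector of a one-dimensional standard graded Cohen-Macaulay ring (with a linear
nonzerodivisor) is `(h₀, …, h_s)` iff its Hilbert function satisfies
`dim_k 𝒜_i = h₀ + ⋯ + h_min(i,s)`.  `hVector1 𝒜 hs` says the h-vector is the list `hs`. -/
def HasHVector1 (hs : List ℕ) : Prop :=
  ∀ i : ℕ, Module.finrank k (𝒜 i) = ((hs.take (i + 1)).sum)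

/-- `z` lies in the span of `1` and `a`. -/
def InSpanOneL {K D : Type} [Field K] [CommRing D] [Algebra K D] (a z : D) : Prop :=
  ∃ p q : K, z = algebraMap K D p + algebraMap K D q * a

/-- `z` lies in the span of `1`, `a` and `b`. -/
def InSpanOneLL {K D : Type} [Field K] [CommRing D] [Algebra K D] (a b z : D) : Prop :=
  ∃ p q r : K, z = algebraMap K D p + algebraMap K D q * a + algebraMap K D r * b

section FiniteAlgebra

variable {K D : Type} [Field K] [CommRing D] [Algebra K D]

local notation "C" => algebraMap K D

lemma exists_not_inSpanOneLL (h : 4 ≤ Module.finrank K D) (a b : D) :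
    ∃ c : D, ¬ InSpanOneLL (K := K) a b c := by
  classical
  by_contra! hc
  have htop : Submodule.span K (({1, a, b} : Finset D) : Set D) = ⊤ := by
    rw [eq_top_iff]
    intro z _
    obtain ⟨p, q, r, rfl⟩ := hc z
    simp only [Finset.coe_insert, Finset.coe_singleton]
    refine Submodule.mem_span_triple.2 ⟨p, q, r, ?_⟩
    simp [Algebra.smul_def]
  have h1 := finrank_span_finset_le_card (R := K) ({1, a, b} : Finset D)
  rw [Set.finrank, htop, finrank_top] at h1
  have := Finset.card_le_three (a := (1 : D)) (b := a) (c := b)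
  omega

lemma InSpanOneL.inSpanOneLL {a z : D} (b : D) (h : InSpanOneL (K := K) a z) :
    InSpanOneLL (K := K) a b z := by
  obtain ⟨p, q, rfl⟩ := h
  exact ⟨p, q, 0, by simp⟩

lemma coeff_eq_zero_of_not_inSpanOneLL {a b c : D} (h : ¬ InSpanOneLL (K := K) a b c)
    {p q r s : K} (e : C p + C q * a + C r * b + C s * c = 0) : s = 0 := by
  by_contra hs
  have h1 : C s⁻¹ * C s = 1 := by rw [← map_mul, inv_mul_cancel₀ hs, map_one]
  refine h ⟨-(s⁻¹ * p), -(s⁻¹ * q), -(s⁻¹ * r), ?_⟩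
  simp only [map_mul, map_neg]
  linear_combination (C s⁻¹) * e - c * h1

lemma coeff_eq_zero_of_not_inSpanOneL {a b : D} (h : ¬ InSpanOneL (K := K) a b)
    {p q r : K} (e : C p + C q * a + C r * b = 0) : r = 0 := by
  by_contra hs
  have h1 : C r⁻¹ * C r = 1 := by rw [← map_mul, inv_mul_cancel₀ hs, map_one]
  refine h ⟨-(r⁻¹ * p), -(r⁻¹ * q), ?_⟩
  simp only [map_mul, map_neg]
  linear_combination (C r⁻¹) * e - b * h1

lemma coeff_eq_zero_of_not_scalar {a : D} (h : ∀ p : K, a ≠ C p)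
    {p q : K} (e : C p + C q * a = 0) : q = 0 := by
  by_contra hs
  have h1 : C q⁻¹ * C q = 1 := by rw [← map_mul, inv_mul_cancel₀ hs, map_one]
  refine h (-(q⁻¹ * p)) ?_
  simp only [map_mul, map_neg]
  linear_combination (C q⁻¹) * e - a * h1

/-- If `1, a, b` span a subalgebra for all `a`, `b`, then every non-scalar `a` has a translate
`a - l` whose multiples are all scalar multiples of it. -/
lemma exists_translate_mul_scalar (h4 : 4 ≤ Module.finrank K D)
    (H : ∀ a b : D, (∀ p : K, a ≠ C p) → ¬ InSpanOneL (K := K) a b →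
      InSpanOneLL (K := K) a b (a * b) ∧ InSpanOneLL (K := K) a b (b * b))
    {a : D} (ha : ∀ p : K, a ≠ C p) :
    ∃ l : K, ∀ c : D, ∃ m : K, (a - C l) * c = C m * (a - C l) := by
  have hspan : ∀ c, ¬ InSpanOneLL (K := K) a a c → ¬ InSpanOneL (K := K) a c :=
    fun c hc h => hc (h.inSpanOneLL a)
  have swap : ∀ c, ¬ InSpanOneL (K := K) a c → (∀ p : K, c ≠ C p) ∧ ¬ InSpanOneL (K := K) c a := by
    intro c hc
    refine ⟨fun p hp => hc ⟨p, 0, by simp [hp]⟩, ?_⟩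
    rintro ⟨p, q, e⟩
    have hq : q ≠ 0 := by
      rintro rfl
      exact ha p (by simp [e])
    exact hq (coeff_eq_zero_of_not_inSpanOneL hc (p := p) (q := -1) (r := q)
      (by simp only [map_neg, map_one]; linear_combination -e))
  obtain ⟨b, hb⟩ := exists_not_inSpanOneLL h4 a a
  have hb := hspan b hb
  obtain ⟨c₀, hc₀⟩ := exists_not_inSpanOneLL h4 a b
  have hc₀' : ¬ InSpanOneL (K := K) a c₀ := fun h => hc₀ (h.inSpanOneLL b)
  obtain ⟨sp, sq, hsq⟩ : InSpanOneL (K := K) a (a * a) := by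
    obtain ⟨p, q, r, e⟩ := (H b a (swap b hb).1 (swap b hb).2).2
    obtain ⟨p', q', r', e'⟩ := (H c₀ a (swap c₀ hc₀').1 (swap c₀ hc₀').2).2
    have : q' = 0 := coeff_eq_zero_of_not_inSpanOneLL hc₀ (p := p' - p) (q := r' - r) (r := -q)
      (by simp only [map_neg, map_sub]; linear_combination e - e')
    subst this
    exact ⟨p', r', by simpa using e'⟩
  obtain ⟨p, q, l, e⟩ := (H a b ha hb).1
  -- multiplication by `a - l` maps everything into the span of `1, a`
  have key : ∀ c, InSpanOneL (K := K) a ((a - C l) * c) := by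
    intro c
    by_cases hc : InSpanOneLL (K := K) a b c
    · obtain ⟨u, v, w, rfl⟩ := hc
      refine ⟨- l * u + v * sp + w * p, u + v * sq - l * v + w * q, ?_⟩
      simp only [map_mul, map_add, map_sub, map_neg]
      linear_combination (C v) * hsq + C w * e
    · have hc' : ¬ InSpanOneL (K := K) a c := fun h => hc (h.inSpanOneLL b)
      have hbc : ¬ InSpanOneL (K := K) a (b + c) := by
        rintro ⟨u, v, h⟩
        exact hc ⟨u, v, -1, by simp only [map_neg, map_one]; linear_combination h⟩
      obtain ⟨p', q', l', e'⟩ := (H a c ha hc').1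
      obtain ⟨p'', q'', l'', e''⟩ := (H a (b + c) ha hbc).1
      have h1 : l' - l'' = 0 := coeff_eq_zero_of_not_inSpanOneLL hc (p := p + p' - p'')
        (q := q + q' - q'') (r := l - l'') (by
          simp only [map_add, map_sub]; linear_combination e'' - e - e')
      have h2 : l - l'' = 0 := coeff_eq_zero_of_not_inSpanOneL hb (p := p + p' - p'')
        (q := q + q' - q'') (by
          have h1' : C l' - C l'' = 0 := by rw [← map_sub, h1, map_zero]
          simp only [map_add, map_sub]; linear_combination e'' - e - e' - c * h1')
      have h3 : l = l' := by linear_combination h2 - h1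
      subst h3
      exact ⟨p', q', by linear_combination e'⟩
  refine ⟨l, fun c => ?_⟩
  obtain ⟨u, v, h⟩ := key c
  -- the coefficient of `1` relative to the basis `1, a - l` vanishes, as `a - l` is not a unit
  have hz : u + v * l = 0 := by
    by_contra hne
    have hinv : C (u + v * l)⁻¹ * C (u + v * l) = 1 := by
      rw [← map_mul, inv_mul_cancel₀ hne, map_one]
    apply hb
    obtain ⟨x, y, hx⟩ := key (C (u + v * l)⁻¹ * (c - C v) * b)
    refine ⟨x, y, ?_⟩
    rw [← hx]
    simp only [map_mul, map_add] at hinv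
    linear_combination (-b) * hinv - (C (u + v * l)⁻¹ * b) * h
  refine ⟨v, ?_⟩
  have hz' : C u + C v * C l = 0 := by rw [← map_mul, ← map_add, hz, map_zero]
  linear_combination h + hz'

/-- In an algebra of dimension at least four there are `a`, `b` with `1, a, b` independent which
either do not span a subalgebra, or generate an ideal of square zero. -/
lemma exists_pair (h4 : 4 ≤ Module.finrank K D) :
    ∃ a b : D, (∀ p : K, a ≠ C p) ∧ ¬ InSpanOneL (K := K) a b ∧
      ((¬ InSpanOneLL (K := K) a b (a * b) ∨ ¬ InSpanOneLL (K := K) a b (b * b)) ∨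
        (a * a = 0 ∧ a * b = 0 ∧ b * b = 0)) := by
  by_contra! hcon
  have H : ∀ a b : D, (∀ p : K, a ≠ C p) → ¬ InSpanOneL (K := K) a b →
      InSpanOneLL (K := K) a b (a * b) ∧ InSpanOneLL (K := K) a b (b * b) :=
    fun a b ha hb => (hcon a b ha hb).1
  have tr := fun a (ha : ∀ p : K, a ≠ C p) => exists_translate_mul_scalar h4 H ha
  obtain ⟨a₀, ha₀⟩ := exists_not_inSpanOneLL (K := K) h4 0 0
  obtain ⟨b₀, hb₀⟩ := exists_not_inSpanOneLL (K := K) h4 a₀ a₀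
  obtain ⟨c₀, hc₀⟩ := exists_not_inSpanOneLL (K := K) h4 a₀ b₀
  have ha₁ : ∀ p : K, a₀ ≠ C p := fun p hp => ha₀ ⟨p, 0, 0, by simp [hp]⟩
  obtain ⟨la, hla⟩ := tr a₀ ha₁
  obtain ⟨lb, hlb⟩ := tr b₀ (fun p hp => hb₀ ⟨p, 0, 0, by simp [hp]⟩)
  obtain ⟨lc, hlc⟩ := tr c₀ (fun p hp => hc₀ ⟨p, 0, 0, by simp [hp]⟩)
  obtain ⟨a, rfl⟩ : ∃ a, a₀ = a + C la := ⟨a₀ - C la, by ring⟩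
  obtain ⟨b, rfl⟩ : ∃ b, b₀ = b + C lb := ⟨b₀ - C lb, by ring⟩
  obtain ⟨c, rfl⟩ : ∃ c, c₀ = c + C lc := ⟨c₀ - C lc, by ring⟩
  simp only [add_sub_cancel_right] at hla hlb hlc
  have ha : ∀ p : K, a ≠ C p := fun p hp => ha₁ (p + la) (by rw [hp, map_add])
  have hb : ¬ InSpanOneL (K := K) a b := by
    rintro ⟨p, q, e⟩
    exact hb₀ ⟨p + lb - q * la, q, 0, by
      simp only [map_add, map_sub, map_mul, map_zero]; linear_combination e⟩
  have hc : ¬ InSpanOneLL (K := K) a b c := by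
    rintro ⟨p, q, r, e⟩
    exact hc₀ ⟨p + lc - q * la - r * lb, q, r, by
      simp only [map_add, map_sub, map_mul]; linear_combination e⟩
  have hac' : ¬ InSpanOneL (K := K) a c := fun h => hc (h.inSpanOneLL b)
  have hbc' : ¬ InSpanOneL (K := K) b c := by
    rintro ⟨p, q, e⟩
    exact hc ⟨p, 0, q, by simp [e]⟩
  have mul_zero_of : ∀ {x y : D}, (∀ c : D, ∃ m : K, x * c = C m * x) →
      (∀ c : D, ∃ m : K, y * c = C m * y) → ¬ InSpanOneL (K := K) x y → x * y = 0 := by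
    intro x y hx hy hxy
    obtain ⟨m, hm⟩ := hx y
    obtain ⟨m', hm'⟩ := hy x
    have : m' = 0 := coeff_eq_zero_of_not_inSpanOneL hxy (p := 0) (q := -m) (by
      simp only [map_neg, map_zero]; linear_combination hm - hm')
    rw [mul_comm, hm', this]; simp
  have hab := mul_zero_of hla hlb hb
  have hac := mul_zero_of hla hlc hac'
  have hbc := mul_zero_of hlb hlc hbc'
  obtain ⟨l, hl⟩ := tr (a + b) (fun p hp => hb ⟨p, -1, by
    simp only [map_neg, map_one]; linear_combination hp⟩)
  have hl0 : l = 0 := by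
    obtain ⟨m, hm⟩ := hl c
    simpa using coeff_eq_zero_of_not_inSpanOneLL hc (p := m * l) (q := -m) (r := -m) (s := -l) (by
      simp only [map_neg, map_mul]; linear_combination hm - hac - hbc)
  subst hl0
  simp only [map_zero, sub_zero] at hl
  refine (hcon a b ha hb).2 ?_ hab ?_
  · obtain ⟨m, hm⟩ := hl a
    obtain ⟨m', hm'⟩ := hla a
    have : m = 0 := by
      simpa using coeff_eq_zero_of_not_inSpanOneL hb (p := 0) (q := m' - m) (r := -m) (by
        simp only [map_neg, map_sub, map_zero]; linear_combination hm - hm' - hab)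
    subst this
    simp only [map_zero, zero_mul] at hm
    linear_combination hm - hab
  · obtain ⟨m, hm⟩ := hl b
    obtain ⟨m', hm'⟩ := hlb b
    have h0 : m' - m = 0 := coeff_eq_zero_of_not_inSpanOneL hb (p := 0) (q := -m) (by
        simp only [map_neg, map_sub, map_zero]; linear_combination hm - hm' - hab)
    have : -m = 0 := coeff_eq_zero_of_not_scalar ha (p := 0) (by
        have h0' : C m' - C m = 0 := by rw [← map_sub, h0, map_zero]
        simp only [map_neg, map_zero]; linear_combination hm - hm' - hab - h0' * b)
    rw [neg_eq_zero] at this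
    subst this
    simp only [map_zero, zero_mul] at hm
    linear_combination hm - hab


/-- There is a line of pairs `1, a + t b` for which the spans of `1, a + s b` and `1, a + t b`
are rarely related by multiplication by a unit. -/
lemma exists_family (h4 : 4 ≤ Module.finrank K D) :
    ∃ a b : D, (∀ p : K, a ≠ C p) ∧ ¬ InSpanOneL (K := K) a b ∧
      {s : K | ¬ {t : K | ∃ v : D, IsUnit v ∧ InSpanOneL (K := K) (a + C s * b) v ∧
        InSpanOneL (K := K) (a + C s * b) (v * (a + C t * b))}.Finite}.Finite := by
  have : Nontrivial D := Module.nontrivial_of_finrank_pos (R := K) (by omega)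
  obtain ⟨a, b, ha, hb, h⟩ := exists_pair h4
  refine ⟨a, b, ha, hb, ?_⟩
  rcases h with h | ⟨haa, hab, hbb⟩
  · refine Set.Subsingleton.finite (s := {s : K | _}) ?_ |>.subset (s := {s : K |
        InSpanOneLL (K := K) a b (b * (a + C s * b))}) ?_
    · rintro s ⟨p, q, r, e⟩ s' ⟨p', q', r', e'⟩
      by_contra hne
      have hinv : C (s - s')⁻¹ * C (s - s') = 1 := by
        rw [← map_mul, inv_mul_cancel₀ (sub_ne_zero.2 hne), map_one]
      have hbb : b * b = C ((s - s')⁻¹ * (p - p')) + C ((s - s')⁻¹ * (q - q')) * a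
          + C ((s - s')⁻¹ * (r - r')) * b := by
        simp only [map_mul, map_sub] at hinv ⊢
        linear_combination (-b * b) * hinv + C (s - s')⁻¹ * (e - e')
      refine h.elim (fun h => h ?_) (fun h => h ⟨_, _, _, hbb⟩)
      refine ⟨p - s * ((s - s')⁻¹ * (p - p')), q - s * ((s - s')⁻¹ * (q - q')),
        r - s * ((s - s')⁻¹ * (r - r')), ?_⟩
      rw [map_sub, map_sub, map_sub, map_mul C s, map_mul C s, map_mul C s]
      linear_combination e - C s * hbb
    · intro s hs
      by_contra hs'
      apply hs
      refine Set.Finite.subset (s := {s} ∪ {t : K | t ≠ s ∧ ∃ v : D, IsUnit v ∧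
        InSpanOneL (K := K) (a + C s * b) v ∧
        InSpanOneL (K := K) (a + C s * b) (v * (a + C t * b))})
        ((Set.finite_singleton s).union (Set.Subsingleton.finite ?_)) ?_
      · have main : ∀ t : K, t ≠ s → (∃ v : D, IsUnit v ∧ InSpanOneL (K := K) (a + C s * b) v ∧
            InSpanOneL (K := K) (a + C s * b) (v * (a + C t * b))) →
            InSpanOneLL (K := K) a b ((a + C s * b) * (a + C t * b)) := by
          rintro t hts ⟨v, hv, ⟨p, q, rfl⟩, ⟨u, w, e⟩⟩
          by_cases hq : q = 0
          · subst hq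
            have e1 : p * t - w * s = 0 := coeff_eq_zero_of_not_inSpanOneL hb (p := -u)
              (q := p - w) (by
                simp only [map_sub, map_neg, map_mul, map_zero] at e ⊢; linear_combination e)
            have e2 : p - w = 0 := coeff_eq_zero_of_not_scalar ha (p := -u) (by
                have e1' : C p * C t - C w * C s = 0 := by
                  rw [← map_mul, ← map_mul, ← map_sub, e1, map_zero]
                simp only [map_sub, map_neg, map_zero] at e ⊢
                linear_combination e - b * e1')
            have e3 : p = 0 := by
              have : p * (t - s) = 0 := by linear_combination e1 - s * e2
              exact (mul_eq_zero.1 this).resolve_right (sub_ne_zero.2 hts)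
            subst e3
            simp at hv
          · have hinv : C q⁻¹ * C q = 1 := by rw [← map_mul, inv_mul_cancel₀ hq, map_one]
            refine ⟨q⁻¹ * u, q⁻¹ * (w - p), q⁻¹ * (w * s - p * t), ?_⟩
            simp only [map_sub, map_mul]
            linear_combination C q⁻¹ * e - ((a + C s * b) * (a + C t * b)) * hinv
        rintro t ⟨hts, ht⟩ t' ⟨hts', ht'⟩
        obtain ⟨p, q, r, e⟩ := main t hts ht
        obtain ⟨p', q', r', e'⟩ := main t' hts' ht'
        by_contra hne
        have hinv : C (t - t')⁻¹ * C (t - t') = 1 := by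
          rw [← map_mul, inv_mul_cancel₀ (sub_ne_zero.2 hne), map_one]
        refine hs' ⟨(t - t')⁻¹ * (p - p'), (t - t')⁻¹ * (q - q'), (t - t')⁻¹ * (r - r'), ?_⟩
        simp only [map_mul, map_sub] at hinv ⊢
        linear_combination (-b * (a + C s * b)) * hinv + C (t - t')⁻¹ * (e - e')
      · intro t ht
        by_cases hts : t = s
        · exact Or.inl hts
        · exact Or.inr ⟨hts, ht⟩
  · convert Set.finite_empty
    rw [Set.eq_empty_iff_forall_notMem]
    intro s hs
    refine hs ((Set.finite_singleton s).subset ?_)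
    rintro t ⟨v, hv, ⟨p, q, rfl⟩, ⟨u, w, e⟩⟩
    have hp : p ≠ 0 := by
      rintro rfl
      have : (C 0 + C q * (a + C s * b)) * (C 0 + C q * (a + C s * b)) = 0 := by
        rw [map_zero]
        linear_combination C q * C q * (haa + 2 * C s * hab + C s * C s * hbb)
      exact (hv.mul hv).ne_zero this
    have e1 : p * t - w * s = 0 := coeff_eq_zero_of_not_inSpanOneL hb (p := -u)
      (q := p - w) (by
        simp only [map_sub, map_neg, map_mul]
        linear_combination e - C q * (haa + (C s + C t) * hab + C s * C t * hbb))
    have e2 : p - w = 0 := coeff_eq_zero_of_not_scalar ha (p := -u) (by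
        have e1' : C p * C t - C w * C s = 0 := by
          rw [← map_mul, ← map_mul, ← map_sub, e1, map_zero]
        simp only [map_sub, map_neg]
        linear_combination e - C q * (haa + (C s + C t) * hab + C s * C t * hbb) - b * e1')
    have : p * (t - s) = 0 := by linear_combination e1 - s * e2
    exact sub_eq_zero.1 ((mul_eq_zero.1 this).resolve_left hp)

lemma finite_idempotents [IsArtinianRing D] : {e : D | IsIdempotentElem e}.Finite := by
  have : Finite (TopologicalSpace.Clopens (PrimeSpectrum D)) :=
    Finite.of_injective (fun s => (s : Set (PrimeSpectrum D))) SetLike.coe_injective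
  have : Finite {e : D // IsIdempotentElem e} :=
    Finite.of_equiv _ (PrimeSpectrum.isIdempotentElemEquivClopens (R := D)).symm.toEquiv
  exact Set.finite_coe_iff.1 this

/-- Only finitely many of the spans of `1, a + t b` contain a nontrivial idempotent. -/
lemma finite_setOf_idempotent [IsArtinianRing D] {a b : D} (ha : ∀ p : K, a ≠ C p)
    (hb : ¬ InSpanOneL (K := K) a b) :
    {t : K | ∃ f : D, IsIdempotentElem f ∧ InSpanOneL (K := K) (a + C t * b) f ∧
      f ≠ 0 ∧ f ≠ 1}.Finite := by
  have hfin := finite_idempotents (D := D)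
  choose! f hf using fun t (ht : t ∈ {t : K | ∃ f : D, IsIdempotentElem f ∧
    InSpanOneL (K := K) (a + C t * b) f ∧ f ≠ 0 ∧ f ≠ 1}) => ht
  refine Set.Finite.of_finite_image (f := f) (hfin.subset ?_) ?_
  · rintro _ ⟨t, ht, rfl⟩
    exact (hf t ht).1
  · intro t ht t' ht' hff
    obtain ⟨hid, ⟨p, q, e⟩, h0, h1⟩ := hf t ht
    obtain ⟨-, ⟨p', q', e'⟩, -, -⟩ := hf t' ht'
    rw [← hff] at e'
    have e1 : q * t - q' * t' = 0 := coeff_eq_zero_of_not_inSpanOneL hb (p := p - p')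
      (q := q - q') (by
        simp only [map_sub, map_mul]; linear_combination e' - e)
    have e2 : q - q' = 0 := coeff_eq_zero_of_not_scalar ha (p := p - p') (by
        have e1' : C q * C t - C q' * C t' = 0 := by
          rw [← map_mul, ← map_mul, ← map_sub, e1, map_zero]
        simp only [map_sub]
        linear_combination e' - e - b * e1')
    have hq : q ≠ 0 := by
      rintro rfl
      have hfp : f t = C p := by rw [e]; simp
      have hpp : C (p * (p - 1)) = 0 := by
        have := hid.eq
        rw [hfp] at this
        simp only [map_mul, map_sub, map_one]
        linear_combination this
      have : Nontrivial D := ⟨⟨_, _, h0⟩⟩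
      rw [map_eq_zero_iff _ (algebraMap K D).injective, mul_eq_zero, sub_eq_zero] at hpp
      rcases hpp with rfl | rfl
      · exact h0 (by simp [hfp])
      · exact h1 (by simp [hfp])
    have : q * (t - t') = 0 := by linear_combination e1 - t' * e2
    exact sub_eq_zero.1 ((mul_eq_zero.1 this).resolve_left hq)

end FiniteAlgebra

section Graded

variable {k R 𝒜}

lemma eq_zero_of_mem_span_sub_one [GradedAlgebra 𝒜] {x : R} (hx : x ∈ 𝒜 1)
    (hx0 : x ∈ nonZeroDivisors R) {d : ℕ} {r : R} (hr : r ∈ 𝒜 d)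
    (hmem : r ∈ Ideal.span {x - 1}) : r = 0 := by
  classical
  obtain ⟨g, hg⟩ := Ideal.mem_span_singleton'.1 hmem
  have hg' : g * x = g + r := by rw [← hg]; ring
  have h0 : ∀ i, (DirectSum.decompose 𝒜 (g * x) i : R)
      = DirectSum.decompose 𝒜 g i + DirectSum.decompose 𝒜 r i := by
    intro i
    rw [hg', DirectSum.decompose_add]
    rfl
  have hs : ∀ i, (DirectSum.decompose 𝒜 (g * x) (i + 1) : R) = DirectSum.decompose 𝒜 g i * x :=
    fun i => DirectSum.coe_decompose_mul_add_of_right_mem 𝒜 hx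
  have hz : (DirectSum.decompose 𝒜 (g * x) 0 : R) = 0 :=
    DirectSum.coe_decompose_mul_of_right_mem_of_not_le 𝒜 hx (by omega)
  have hlow : ∀ i, i < d → (DirectSum.decompose 𝒜 g i : R) = 0 := by
    intro i
    induction i with
    | zero =>
      intro hi
      have := h0 0
      rw [hz, DirectSum.decompose_of_mem_ne 𝒜 hr (by omega), add_zero] at this
      exact this.symm
    | succ i ih =>
      intro hi
      have := h0 (i + 1)
      rw [hs, ih (by omega), DirectSum.decompose_of_mem_ne 𝒜 hr (by omega), add_zero,
        zero_mul] at this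
      exact this.symm
  have hhigh : ∀ j, (DirectSum.decompose 𝒜 g (d + j) : R) = - (r * x ^ j) := by
    intro j
    induction j with
    | zero =>
      have := h0 d
      rw [DirectSum.decompose_of_mem_same 𝒜 hr] at this
      rcases d with _ | d
      · rw [hz] at this
        simp only [pow_zero, mul_one]
        linear_combination -this
      · rw [hs, hlow d (by omega)] at this
        simp only [pow_zero, mul_one]
        linear_combination -this
    | succ j ih =>
      have := h0 (d + j + 1)
      rw [hs, ih, DirectSum.decompose_of_mem_ne 𝒜 hr (by omega)] at this
      rw [← add_assoc]
      linear_combination -this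
  obtain ⟨M, hM⟩ := Finset.exists_nat_subset_range (DirectSum.decompose 𝒜 g).support
  have hvan : (DirectSum.decompose 𝒜 g (d + M) : R) = 0 := by
    by_contra hne
    have : d + M ∈ (DirectSum.decompose 𝒜 g).support := by
      rw [DFinsupp.mem_support_iff]
      intro h
      exact hne (by rw [h]; rfl)
    have := Finset.mem_range.1 (hM this)
    omega
  rw [hhigh, neg_eq_zero] at hvan
  exact (mul_right_mem_nonZeroDivisors_eq_zero_iff (pow_mem hx0 M)).1 hvan

/-- An algebra map out of a graded algebra extends to polynomials, with the degree recorded by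
the variable. -/
lemma exists_homogenize [GradedAlgebra 𝒜] {D : Type} [CommRing D] [Algebra k D] (f : R →ₐ[k] D) :
    ∃ ρ : R →ₐ[k] Polynomial D, ∀ r i, (ρ r).coeff i = f (DirectSum.decompose 𝒜 r i) := by
  classical
  let F : ∀ i, 𝒜 i →ₗ[k] Polynomial D := fun i =>
    ((Polynomial.monomial i).restrictScalars k).comp (f.toLinearMap.comp (𝒜 i).subtype)
  have hF : ∀ i (r : 𝒜 i), F i r = Polynomial.monomial i (f r) := fun i r => rfl
  have hone : F 0 (GradedMonoid.GOne.one (A := fun i => 𝒜 i)) = 1 := by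
    rw [hF]; simp [GradedMonoid.GOne.one]
  have hmul : ∀ {i j} (a : 𝒜 i) (b : 𝒜 j),
      F (i + j) (GradedMonoid.GMul.mul (A := fun i => 𝒜 i) a b) = F _ a * F _ b := by
    intro i j a b; simp [hF, GradedMonoid.GMul.mul, Polynomial.monomial_mul_monomial]
  let T := DirectSum.toAlgebra k (fun i => 𝒜 i) F hone hmul
  refine ⟨T.comp (DirectSum.decomposeAlgEquiv 𝒜).toAlgHom, fun r i => ?_⟩
  have hT : ∀ j (a : 𝒜 j), T (DirectSum.of (fun i => 𝒜 i) j a) = F j a :=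
    fun j a => DirectSum.toSemiring_of (fun i => (F i).toAddMonoidHom) hone hmul j a
  induction r using DirectSum.Decomposition.inductionOn 𝒜 with
  | zero => simp
  | @homogeneous j m =>
    change (T (DirectSum.decompose 𝒜 (m : R))).coeff i = _
    rw [DirectSum.decompose_coe, hT, hF, Polynomial.coeff_monomial]
    split_ifs with h
    · subst h; simp
    · rw [DirectSum.of_eq_of_ne _ _ _ (Ne.symm h)]; simp
  | add a b ha hb =>
    rw [map_add, Polynomial.coeff_add, ha, hb, DirectSum.decompose_add, ← map_add]
    rfl

/-- A one-dimensional standard graded ring of minimal multiplicity is a subring of a polynomial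
ring over a finite-dimensional algebra `D`, with `D X` as its degree one part. -/
lemma exists_polynomial_model [GradedAlgebra 𝒜] (hstd0 : 𝒜 0 = (1 : Submodule k R))
    {x : R} (hx : x ∈ 𝒜 1) (hx0 : x ∈ nonZeroDivisors R) {n : ℕ}
    (hn : HasHVector1 k R 𝒜 [1, n]) :
    ∃ (D : Type) (_ : CommRing D) (_ : Algebra k D) (ρ : R →ₐ[k] Polynomial D),
      Function.Injective ρ ∧ Module.finrank k D = n + 1 ∧ ρ x = Polynomial.X ∧
      (∀ d : D, ∃ u ∈ 𝒜 1, ρ u = Polynomial.C d * Polynomial.X) ∧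
      ∀ r, ∃ c : k, (ρ r).coeff 0 = algebraMap k D c := by
  classical
  have hrank : ∀ i, Module.finrank k (𝒜 (i + 1)) = n + 1 := by
    intro i
    rw [hn (i + 1)]
    simp only [List.take_succ_cons, List.take_nil, List.sum_cons, List.sum_nil]
    omega
  let f : R →ₐ[k] R ⧸ Ideal.span {x - 1} := Ideal.Quotient.mkₐ k _
  have hfx : f x = 1 := by
    rw [← map_one f]
    exact Ideal.Quotient.eq.2 (Ideal.subset_span rfl)
  have hinj : ∀ d, ∀ r ∈ 𝒜 d, f r = 0 → r = 0 := fun d r hr h =>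
    eq_zero_of_mem_span_sub_one hx hx0 hr (Ideal.Quotient.eq_zero_iff_mem.1 h)
  have hxi : ∀ i, x ^ i ∈ 𝒜 i := fun i => by
    simpa using SetLike.pow_mem_graded i hx
  have hsurj : ∀ r : R, ∃ u ∈ 𝒜 1, f u = f r := by
    intro r
    induction r using DirectSum.Decomposition.inductionOn 𝒜 with
    | zero => exact ⟨0, zero_mem _, rfl⟩
    | @homogeneous j m =>
      obtain ⟨m, hm⟩ := m
      rcases j with _ | j
      · refine ⟨m * x, by simpa using SetLike.mul_mem_graded hm hx, by simp [hfx]⟩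
      · let L : 𝒜 1 →ₗ[k] 𝒜 (j + 1) :=
          ((LinearMap.mulLeft k (x ^ j)).comp (𝒜 1).subtype).codRestrict
          (𝒜 (j + 1)) (fun u => SetLike.mul_mem_graded (hxi j) u.2)
        have hL : ∀ u, (L u : R) = x ^ j * u := fun u => rfl
        have hLinj : Function.Injective L := by
          rw [injective_iff_map_eq_zero]
          intro u hu
          have : x ^ j * (u : R) = 0 := by rw [← hL, hu]; rfl
          exact Subtype.ext ((mul_left_mem_nonZeroDivisors_eq_zero_iff (pow_mem hx0 j)).1 this)
        have : FiniteDimensional k (𝒜 1) := Module.finite_of_finrank_pos (by rw [hrank 0]; omega)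
        have : FiniteDimensional k (𝒜 (j + 1)) :=
          Module.finite_of_finrank_pos (by rw [hrank j]; omega)
        obtain ⟨u, hu⟩ := (LinearMap.injective_iff_surjective_of_finrank_eq_finrank
          (by rw [hrank 0, hrank j])).1 hLinj ⟨m, hm⟩
        refine ⟨u, u.2, ?_⟩
        have := congrArg Subtype.val hu
        rw [hL] at this
        change x ^ j * (u : R) = m at this
        change f u = f m
        rw [← this, map_mul, map_pow, hfx, one_pow, one_mul]
    | add a b ha hb =>
      obtain ⟨u, hu, e⟩ := ha
      obtain ⟨v, hv, e'⟩ := hb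
      exact ⟨u + v, add_mem hu hv, by rw [map_add, map_add, e, e']⟩
  obtain ⟨ρ, hρ⟩ := exists_homogenize (𝒜 := 𝒜) f
  have hρ1 : ∀ u ∈ 𝒜 1, ρ u = Polynomial.C (f u) * Polynomial.X := by
    intro u hu
    ext i
    rw [hρ, Polynomial.coeff_C_mul, Polynomial.coeff_X]
    split_ifs with h
    · subst h
      rw [DirectSum.decompose_of_mem_same 𝒜 hu, mul_one]
    · rw [DirectSum.decompose_of_mem_ne 𝒜 hu h]; simp
  refine ⟨R ⧸ Ideal.span {x - 1}, inferInstance, inferInstance, ρ, ?_, ?_, ?_, ?_, ?_⟩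
  · rw [injective_iff_map_eq_zero]
    intro r hr
    have : DirectSum.decompose 𝒜 r = 0 := by
      ext i
      refine hinj i _ (SetLike.coe_mem _) ?_
      rw [← hρ, hr, Polynomial.coeff_zero]
    exact (DirectSum.decompose 𝒜).injective (this.trans (DirectSum.decompose_zero 𝒜).symm)
  · rw [← hrank 0]
    refine (LinearEquiv.finrank_eq (LinearEquiv.ofBijective
      (f.toLinearMap.comp (𝒜 1).subtype) ⟨?_, ?_⟩)).symm
    · rw [injective_iff_map_eq_zero]
      exact fun u hu => Subtype.ext (hinj 1 u u.2 hu)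
    · intro d
      obtain ⟨r, rfl⟩ := Ideal.Quotient.mk_surjective d
      obtain ⟨u, hu, e⟩ := hsurj r
      exact ⟨⟨u, hu⟩, e⟩
  · rw [hρ1 x hx, hfx]; simp
  · intro d
    obtain ⟨r, rfl⟩ := Ideal.Quotient.mk_surjective d
    obtain ⟨u, hu, e⟩ := hsurj r
    exact ⟨u, hu, by rw [hρ1 u hu, e]; rfl⟩
  · intro r
    have h : (DirectSum.decompose 𝒜 r 0 : R) ∈ (1 : Submodule k R) :=
      hstd0 ▸ SetLike.coe_mem (DirectSum.decompose 𝒜 r 0)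
    obtain ⟨c, hc⟩ := Submodule.mem_one.1 h
    exact ⟨c, by rw [hρ, ← hc, AlgHom.commutes]⟩

/-- The degree `j` part of an ideal. -/
def idealGradedPart (𝒜 : ℕ → Submodule k R) (I : Ideal R) (j : ℤ) : AddSubgroup I :=
  if 0 ≤ j then (𝒜 j.toNat).toAddSubgroup.comap I.subtype.toAddMonoidHom else ⊥

lemma mem_idealGradedPart_natCast {I : Ideal R} {n : ℕ} {y : I} :
    y ∈ idealGradedPart 𝒜 I n ↔ (y : R) ∈ 𝒜 n := by
  simp [idealGradedPart]

lemma isInternal_idealGradedPart [GradedAlgebra 𝒜] {I : Ideal R} (hI : I.IsHomogeneous 𝒜) :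
    DirectSum.IsInternal (idealGradedPart 𝒜 I) := by
  classical
  have key : ∀ (f : DirectSum ℤ fun j => idealGradedPart 𝒜 I j) (n : ℕ),
      (DirectSum.decompose 𝒜
        (DirectSum.coeAddMonoidHom (idealGradedPart 𝒜 I) f : R) n : R) = ((f (n : ℤ) : I) : R) := by
    intro f n
    induction f using DirectSum.induction_on with
    | zero => simp
    | of j y =>
      obtain ⟨y, hy⟩ := y
      rw [DirectSum.coeAddMonoidHom_of]
      by_cases hj : 0 ≤ j
      · lift j to ℕ using hj
        have hy' := mem_idealGradedPart_natCast.1 hy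
        by_cases h : j = n
        · subst h
          rw [DirectSum.decompose_of_mem_same 𝒜 hy', DirectSum.of_eq_same]
        · rw [DirectSum.decompose_of_mem_ne 𝒜 hy' h, DirectSum.of_eq_of_ne _ _ _ (by omega)]
          rfl
      · have hy' : y = 0 := by simpa [idealGradedPart, hj] using hy
        subst hy'
        rw [DirectSum.of_eq_of_ne _ _ _ (by omega)]
        simp
    | add f g hf hg =>
      simp only [map_add, Submodule.coe_add, DirectSum.decompose_add, DirectSum.add_apply,
        AddSubgroup.coe_add, hf, hg]
  constructor
  · rw [injective_iff_map_eq_zero]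
    intro f hf
    ext j
    by_cases hj : 0 ≤ j
    · lift j to ℕ using hj
      rw [← key f j, hf]
      simp
    · have := (f j).2
      have : (f j : I) = 0 := by
        simpa only [idealGradedPart, hj, if_false, AddSubgroup.mem_bot] using this
      rw [this]; rfl
  · intro y
    let c : ℕ → I := fun n => ⟨DirectSum.decompose 𝒜 (y : R) n, hI n y.2⟩
    refine ⟨∑ n ∈ (DirectSum.decompose 𝒜 (y : R)).support,
      DirectSum.of (fun j => idealGradedPart 𝒜 I j) (n : ℤ)
        ⟨c n, mem_idealGradedPart_natCast.2 (SetLike.coe_mem _)⟩, ?_⟩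
    rw [map_sum]
    simp only [DirectSum.coeAddMonoidHom_of]
    apply Subtype.ext
    rw [AddSubmonoidClass.coe_finsetSum]
    exact DirectSum.sum_support_decompose 𝒜 (y : R)

/-- A homogeneous ideal as a graded module. -/
def idealGrMod [GradedAlgebra 𝒜] (I : Ideal R) (hI : I.IsHomogeneous 𝒜) : GrMod k R 𝒜 where
  M := I
  gr := idealGradedPart 𝒜 I
  internal := isInternal_idealGradedPart hI
  smul_mem i j r y hr hy := by
    by_cases hj : 0 ≤ j
    · lift j to ℕ using hj
      have := mem_idealGradedPart_natCast.1 hy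
      have h : r • y ∈ idealGradedPart 𝒜 I ((i + j : ℕ) : ℤ) :=
        mem_idealGradedPart_natCast.2 (SetLike.mul_mem_graded hr this)
      exact_mod_cast h
    · have hy' : y = 0 := by simpa [idealGradedPart, hj] using hy
      rw [hy', smul_zero]
      exact zero_mem _

lemma polynomial_eq_zero_of_X_mul_eq_mul_self {D : Type} [CommRing D] {g : Polynomial D}
    (h : Polynomial.X * g = g * g) (h0 : g.coeff 0 = 0) (h1 : g.coeff 1 = 0) : g = 0 := by
  have hdvd : ∀ n, (Polynomial.X : Polynomial D) ^ (n + 2) ∣ g := by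
    intro n
    induction n with
    | zero =>
      rw [Polynomial.X_pow_dvd_iff]
      intro d hd
      interval_cases d <;> assumption
    | succ n ih =>
      obtain ⟨q, hq⟩ := ih
      refine ⟨Polynomial.X ^ n * (q * q), Polynomial.monic_X.isRegular.left ?_⟩
      change Polynomial.X * g = Polynomial.X * _
      rw [h, hq]
      ring
  ext i
  exact Polynomial.X_pow_dvd_iff.1 (hdvd i) i (by omega)

lemma coeff_two_mul {D : Type} [CommRing D] {p q : Polynomial D} (hp : p.coeff 0 = 0)
    (hq : q.coeff 0 = 0) : (p * q).coeff 2 = p.coeff 1 * q.coeff 1 := by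
  simp [Polynomial.coeff_mul, Finset.Nat.antidiagonal_succ, hp, hq]

section Model

variable {D : Type} [CommRing D] [Algebra k D] {ρ : R →ₐ[k] Polynomial D} {x : R}

lemma coeff_of_mem_span_pair (hρx : ρ x = Polynomial.X)
    (hρ0 : ∀ r, ∃ c : k, (ρ r).coeff 0 = algebraMap k D c) {u : R} {d : D}
    (hu : ρ u = Polynomial.C d * Polynomial.X) {y : R} (hy : y ∈ Ideal.span {x, u}) :
    (ρ y).coeff 0 = 0 ∧ InSpanOneL (K := k) d ((ρ y).coeff 1) := by
  obtain ⟨r, r', rfl⟩ := Ideal.mem_span_pair.1 hy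
  obtain ⟨c, hc⟩ := hρ0 r
  obtain ⟨c', hc'⟩ := hρ0 r'
  refine ⟨by simp [hρx, hu], c, c', ?_⟩
  rw [map_add, map_mul, map_mul, hρx, hu, ← mul_assoc, Polynomial.coeff_add,
    Polynomial.coeff_mul_X, Polynomial.coeff_mul_X, Polynomial.coeff_mul_C, hc, hc']

/-- The ideal `(x, u)` is indecomposable unless the span of `1` and `d` contains a nontrivial
idempotent, where `u` corresponds to `d X`. -/
lemma eq_bot_or_eq_bot_of_isCompl (hρ : Function.Injective ρ) (hρx : ρ x = Polynomial.X)
    (hρ0 : ∀ r, ∃ c : k, (ρ r).coeff 0 = algebraMap k D c) {u : R} {d : D}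
    (hu : ρ u = Polynomial.C d * Polynomial.X) (hx0 : x ∈ nonZeroDivisors R)
    (hid : ∀ f : D, IsIdempotentElem f → InSpanOneL (K := k) d f → f = 0 ∨ f = 1)
    (p q : Submodule R (Ideal.span {x, u})) (hpq : IsCompl p q) : p = ⊥ ∨ q = ⊥ := by
  have hxI : x ∈ Ideal.span {x, u} := Ideal.subset_span (by simp)
  obtain ⟨P, hP, Q, hQ, hPQ⟩ := Submodule.mem_sup.1
    (hpq.sup_eq_top ▸ Submodule.mem_top : (⟨x, hxI⟩ : Ideal.span {x, u}) ∈ p ⊔ q)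
  have hsum : (P : R) + Q = x := congrArg Subtype.val hPQ
  have hmul : ∀ y ∈ p, ∀ z ∈ q, (y : R) * z = 0 := by
    intro y hy z hz
    have h1 : (y : R) • z ∈ q := q.smul_mem _ hz
    have h2 : (y : R) • z ∈ p := by
      have : (y : R) • z = (z : R) • y := Subtype.ext (mul_comm _ _)
      rw [this]
      exact p.smul_mem _ hy
    have : (y : R) • z ∈ p ⊓ q := ⟨h2, h1⟩
    rw [hpq.inf_eq_bot, Submodule.mem_bot] at this
    exact congrArg Subtype.val this
  have hPQ0 := hmul P hP Q hQ
  obtain ⟨hP0, hP1⟩ := coeff_of_mem_span_pair hρx hρ0 hu P.2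
  obtain ⟨hQ0, -⟩ := coeff_of_mem_span_pair hρx hρ0 hu Q.2
  have hρsum : ρ P + ρ Q = Polynomial.X := by rw [← map_add, hsum, hρx]
  have hρmul : ρ P * ρ Q = 0 := by rw [← map_mul, hPQ0, map_zero]
  have hXP : Polynomial.X * ρ P = ρ P * ρ P := by
    rw [← hρsum]; linear_combination hρmul
  have hXQ : Polynomial.X * ρ Q = ρ Q * ρ Q := by
    rw [← hρsum]; linear_combination hρmul
  have hidem : IsIdempotentElem ((ρ P).coeff 1) := by
    have h := congrArg (fun f => Polynomial.coeff f 2) hXP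
    simp only [coeff_two_mul hP0 hP0, Polynomial.coeff_X_mul] at h
    exact h.symm
  rcases hid _ hidem hP1 with h | h
  · left
    have hPz : (P : R) = 0 := hρ (by
      rw [polynomial_eq_zero_of_X_mul_eq_mul_self hXP hP0 h, map_zero])
    rw [hPz, zero_add] at hsum
    rw [Submodule.eq_bot_iff]
    intro y hy
    have := hmul y hy Q hQ
    rw [hsum] at this
    exact Subtype.ext ((mul_right_mem_nonZeroDivisors_eq_zero_iff hx0).1 this)
  · right
    have hQ1 : (ρ Q).coeff 1 = 0 := by
      have := congrArg (fun f => Polynomial.coeff f 1) hρsum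
      simp only [Polynomial.coeff_add, Polynomial.coeff_X_one, h] at this
      linear_combination this
    have hQz : (Q : R) = 0 := hρ (by
      rw [polynomial_eq_zero_of_X_mul_eq_mul_self hXQ hQ0 hQ1, map_zero])
    rw [hQz, add_zero] at hsum
    rw [Submodule.eq_bot_iff]
    intro z hz
    have := hmul P hP z hz
    rw [hsum] at this
    exact Subtype.ext ((mul_left_mem_nonZeroDivisors_eq_zero_iff hx0).1 this)

/-- Isomorphic ideals `(x, u)` and `(x, u')` come from spans which differ by a unit of `D`. -/
lemma exists_isUnit_of_linearEquiv (hρx : ρ x = Polynomial.X)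
    (hρ0 : ∀ r, ∃ c : k, (ρ r).coeff 0 = algebraMap k D c) {u u' : R} {d d' : D}
    (hu : ρ u = Polynomial.C d * Polynomial.X) (hu' : ρ u' = Polynomial.C d' * Polynomial.X)
    (e : Ideal.span {x, u} ≃ₗ[R] Ideal.span {x, u'}) :
    ∃ v : D, IsUnit v ∧ InSpanOneL (K := k) d' v ∧ InSpanOneL (K := k) d' (v * d) := by
  let X₁ : Ideal.span {x, u} := ⟨x, Ideal.subset_span (by simp)⟩
  let U₁ : Ideal.span {x, u} := ⟨u, Ideal.subset_span (by simp)⟩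
  let X₂ : Ideal.span {x, u'} := ⟨x, Ideal.subset_span (by simp)⟩
  have hcomm : ∀ y z : Ideal.span {x, u}, (y : R) * (e z : R) = z * e y := by
    intro y z
    have h : (y : R) • z = (z : R) • y := Subtype.ext (mul_comm _ _)
    have := congrArg Subtype.val (congrArg e h)
    rwa [map_smul, map_smul] at this
  obtain ⟨hg0, hg1⟩ := coeff_of_mem_span_pair hρx hρ0 hu' (e X₁).2
  obtain ⟨-, hh1⟩ := coeff_of_mem_span_pair hρx hρ0 hu' (e U₁).2
  obtain ⟨hg0', -⟩ := coeff_of_mem_span_pair hρx hρ0 hu (e.symm X₂).2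
  refine ⟨(ρ (e X₁)).coeff 1, ?_, hg1, ?_⟩
  · have h := hcomm X₁ (e.symm X₂)
    rw [e.apply_symm_apply] at h
    have h := congrArg (fun r => (ρ r).coeff 2) h
    simp only [map_mul, coeff_two_mul hg0' hg0] at h
    have hx : (ρ (X₁ : R)) * ρ (X₂ : R) = Polynomial.X * Polynomial.X := by
      rw [← hρx]
    rw [hx, Polynomial.coeff_X_mul, Polynomial.coeff_X_one] at h
    exact IsUnit.of_mul_eq_one _ (by rw [mul_comm]; exact h.symm)
  · have h := congrArg (fun r => (ρ r).coeff 2) (hcomm X₁ U₁)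
    have hX : ρ (X₁ : R) = Polynomial.X := hρx
    have hU : ρ (U₁ : R) = Polynomial.C d * Polynomial.X := hu
    simp only [map_mul, hX, hU, mul_assoc, Polynomial.coeff_X_mul, Polynomial.coeff_C_mul] at h
    rwa [mul_comm, ← h]

end Model

/-- Rings with h-vector `(1, n)`, `n ≥ 3`, over an uncountable field are not of graded countable
Cohen-Macaulay type. -/
lemma not_hasGradedCountableCMType [Uncountable k] [GradedAlgebra 𝒜]
    (hstd0 : 𝒜 0 = (1 : Submodule k R)) {x : R} (hx : x ∈ 𝒜 1) (hx0 : x ∈ nonZeroDivisors R)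
    {n : ℕ} (hn3 : 3 ≤ n) (hn : HasHVector1 k R 𝒜 [1, n]) :
    ¬ HasGradedCountableCMType k R 𝒜 (gradedIrrelevant k R 𝒜) := by
  rintro ⟨F, hF⟩
  obtain ⟨D, _, _, ρ, hρ, hD, hρx, hρ1, hρ0⟩ := exists_polynomial_model hstd0 hx hx0 hn
  have hfd : FiniteDimensional k D := Module.finite_of_finrank_pos (by omega)
  have : IsArtinianRing D := IsArtinianRing.of_finite k D
  have : Nontrivial D := Module.nontrivial_of_finrank_pos (R := k) (by omega)
  obtain ⟨a, b, ha, hb, hS⟩ := exists_family (K := k) (D := D) (by omega)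
  have hB := finite_setOf_idempotent ha hb
  choose u hu1 hu using fun t : k => hρ1 (a + algebraMap k D t * b)
  have hhom : ∀ t, (Ideal.span {x, u t}).IsHomogeneous 𝒜 := by
    intro t
    refine Ideal.homogeneous_span 𝒜 _ ?_
    rintro y (rfl | rfl)
    · exact ⟨1, hx⟩
    · exact ⟨1, hu1 t⟩
  let N : k → GrMod k R 𝒜 := fun t => idealGrMod (Ideal.span {x, u t}) (hhom t)
  have hnt : ∀ t, Nontrivial (N t).M := by
    intro t
    refine ⟨⟨⟨x, Ideal.subset_span (by simp)⟩, 0, fun h => ?_⟩⟩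
    have h : x = 0 := congrArg Subtype.val h
    rw [h, map_zero] at hρx
    exact Polynomial.X_ne_zero hρx.symm
  have hMCM : ∀ t, GrMod.IsMCM k R 𝒜 (gradedIrrelevant k R 𝒜) (N t) := by
    intro t
    have hfg : (Ideal.span {x, u t}).FG := Submodule.fg_span (Set.toFinite _)
    refine ⟨Module.Finite.iff_fg.2 hfg, hnt t, x,
      Ideal.subset_span ⟨1, one_pos, hx⟩, fun y hy => ?_⟩
    exact Subtype.ext ((mul_left_mem_nonZeroDivisors_eq_zero_iff hx0).1 (congrArg Subtype.val hy))
  set S := {s : k | ¬ {t : k | ∃ v : D, IsUnit v ∧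
    InSpanOneL (K := k) (a + algebraMap k D s * b) v ∧
    InSpanOneL (K := k) (a + algebraMap k D s * b) (v * (a + algebraMap k D t * b))}.Finite}
  set B := {t : k | ∃ f : D, IsIdempotentElem f ∧
    InSpanOneL (K := k) (a + algebraMap k D t * b) f ∧ f ≠ 0 ∧ f ≠ 1}
  have hindec : ∀ t, t ∉ B → GrMod.Indec k R 𝒜 (N t) := by
    intro t ht
    refine ⟨hnt t, eq_bot_or_eq_bot_of_isCompl hρ hρx hρ0 (hu t) hx0 fun f hf hf' => ?_⟩
    by_contra! hcon
    exact ht ⟨f, hf, hf', hcon.1, hcon.2⟩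
  have hfib : ∀ i, {t : k | t ∉ S ∧ GrIsoUpToShift k R 𝒜 (N t) (F i)}.Finite := by
    intro i
    rcases Set.eq_empty_or_nonempty {t : k | t ∉ S ∧ GrIsoUpToShift k R 𝒜 (N t) (F i)} with h | h
    · rw [h]; exact Set.finite_empty
    · obtain ⟨s, hs, es, -⟩ := h
      refine (not_not.1 hs).subset ?_
      rintro t ⟨-, et, -⟩
      exact exists_isUnit_of_linearEquiv hρx hρ0 (hu t) (hu s) (et.trans es.symm)
  refine Set.not_countable_univ (α := k) (((hS.countable.union hB.countable).union
    (Set.countable_iUnion fun i => (hfib i).countable)).mono fun t _ => ?_)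
  by_cases hS' : t ∈ S
  · exact Or.inl (Or.inl hS')
  by_cases hB' : t ∈ B
  · exact Or.inl (Or.inr hB')
  obtain ⟨i, hi⟩ := hF (N t) (hMCM t) (hindec t hB')
  exact Or.inr (Set.mem_iUnion.2 ⟨i, hS', hi⟩)

end Graded

/-- Let `(R, m, k)` be a one-dimensional Cohen-Macaulay standard graded
ring over an uncountable field `k` which is of graded countable Cohen-Macaulay type.
Assume the classification inputs: such an `R` is either a hypersurface with h-vector `(1)`,
`(1,1)` or `(1,1,1)`, or has minimal multiplicity with h-vector `(1,n)`.  Then the h-vector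
of `R` is one of `(1)`, `(1,1)`, `(1,2)`, `(1,1,1)`; in particular the multiplicity
`e(R)` (the eventual value of the Hilbert function `i ↦ dim_k 𝒜_i`) is at most 3. -/
theorem stmt19 [Uncountable k] [GradedAlgebra 𝒜]
    (hstd0 : 𝒜 0 = (1 : Submodule k R))
    (hstd : ∀ i : ℕ, 𝒜 (i + 1) = 𝒜 1 * 𝒜 i)
    (hdim : ringKrullDim R = 1)
    (hCM : ∃ x : R, x ∈ 𝒜 1 ∧ x ∈ nonZeroDivisors R)
    (hcount : HasGradedCountableCMType k R 𝒜 (gradedIrrelevant k R 𝒜))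
    (hclass : (HasHVector1 k R 𝒜 [1] ∨ HasHVector1 k R 𝒜 [1, 1] ∨
        HasHVector1 k R 𝒜 [1, 1, 1]) ∨ ∃ n : ℕ, 1 ≤ n ∧ HasHVector1 k R 𝒜 [1, n]) :
    (HasHVector1 k R 𝒜 [1] ∨ HasHVector1 k R 𝒜 [1, 1] ∨ HasHVector1 k R 𝒜 [1, 2] ∨
      HasHVector1 k R 𝒜 [1, 1, 1]) ∧
    ∃ i₀ : ℕ, ∀ i : ℕ, i₀ ≤ i → Module.finrank k (𝒜 i) ≤ 3 := by
  obtain ⟨x, hx, hx0⟩ := hCM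
  have h : HasHVector1 k R 𝒜 [1] ∨ HasHVector1 k R 𝒜 [1, 1] ∨ HasHVector1 k R 𝒜 [1, 2] ∨
      HasHVector1 k R 𝒜 [1, 1, 1] := by
    rcases hclass with (h | h | h) | ⟨n, hn1, h⟩
    · exact Or.inl h
    · exact Or.inr (Or.inl h)
    · exact Or.inr (Or.inr (Or.inr h))
    · have hn : n < 3 := by
        by_contra! hn3
        exact not_hasGradedCountableCMType hstd0 hx hx0 hn3 h hcount
      interval_cases n
      · exact Or.inr (Or.inl h)
      · exact Or.inr (Or.inr (Or.inl h))
  refine ⟨h, 0, fun i _ => ?_⟩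
  rcases h with h | h | h | h <;> rw [h i] <;>
    rcases i with _ | _ | i <;> simp
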